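/- Let C be a compact convex set with the origin in its interior and let p, q, r, s be four pairwise distinct points, no three collinear. Suppose there exist a point x and λ > 0 such that p, q ∈ ∂(x + λC) and r, s ∉ int(x + λC), and a point y and μ > 0 such that r, s ∈ ∂(y + μC) and p, q ∉ int(y + μC). If additionally the Voronoi-cell condition holds that the quadrilateral regions traced by segments from p and q to a small disk around x, and from r and s to a small disk around y, have intersection of measure zero, then the open segments pq and rs do not cross. (Planarity of the Delaunay graph: DG_C(S) is a plane graph.) -/

import Mathlib

open Metric Set MeasureTheory
open scoped MeasureTheory

noncomputable section

abbrev Pt := EuclideanSpace ℝ (Fin 2)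

def homothet (C : Set Pt) (x : Pt) (l : ℝ) : Set Pt := (fun z => x + l • z) '' C

def dC (C : Set Pt) (x y : Pt) : ℝ := sInf {l : ℝ | 0 ≤ l ∧ y ∈ homothet C x l}

def cross2 (u v : Pt) : ℝ := u 0 * v 1 - u 1 * v 0

def kappa (C : Set Pt) : ℝ :=
  sSup { k : ℝ | ∃ x ∈ frontier C, ∃ y ∈ frontier C, x ≠ y ∧ Collinear ℝ {x, y, (0:Pt)} ∧
      k = max (μH[1] {z ∈ frontier C | 0 ≤ cross2 x z}).toReal
              (μH[1] {z ∈ frontier C | cross2 x z ≤ 0}).toReal / dist x y }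

def baseAngleSet (C : Set Pt) (x y : Pt) : Set ℝ :=
  { θ : ℝ | ∃ a ∈ frontier C, dist a x = dist a y ∧ θ = EuclideanGeometry.angle y x a }

def alphaC (C : Set Pt) : ℝ :=
  sInf { θ : ℝ | ∃ x ∈ frontier C, ∃ y ∈ frontier C, x ≠ y ∧ θ = sSup (baseAngleSet C x y) }

def upperArcLen (D : Set Pt) (a b : Pt) : ℝ :=
  (μH[1] {z ∈ frontier D | 0 ≤ z 1 ∧ min (a 0) (b 0) ≤ z 0 ∧ z 0 ≤ max (a 0) (b 0)}).toReal

def walkLen : List Pt → ℝ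
  | [] => 0
  | [_] => 0
  | a :: b :: l => dist a b + walkLen (b :: l)

def DGadj (C : Set Pt) (S : Finset Pt) (p q : Pt) : Prop :=
  p ∈ S ∧ q ∈ S ∧ p ≠ q ∧ ∃ x : Pt, dC C x p = dC C x q ∧
    ∀ r ∈ S, r ≠ p → r ≠ q → dC C x p < dC C x r
/-- `w` is a convex combination of `p`, `q`, `x`. -/
def InTri (p q x w : Pt) : Prop :=
  ∃ a b c : ℝ, 0 ≤ a ∧ 0 ≤ b ∧ 0 ≤ c ∧ a + b + c = 1 ∧ w = a • p + b • q + c • x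

lemma InTri.of_segment_left {p q x w : Pt} (h : w ∈ segment ℝ p x) : InTri p q x w := by
  obtain ⟨a, b, ha, hb, hab, rfl⟩ := h
  exact ⟨a, 0, b, ha, le_rfl, hb, by linarith, by simp⟩

lemma InTri.of_segment_right {p q x w : Pt} (h : w ∈ segment ℝ q x) : InTri p q x w := by
  obtain ⟨a, b, ha, hb, hab, rfl⟩ := h
  exact ⟨0, a, b, le_rfl, ha, hb, by linarith, by simp⟩

lemma InTri.swap {p q x w : Pt} (h : InTri p q x w) : InTri q p x w := by
  obtain ⟨a, b, c, ha, hb, hc, h1, rfl⟩ := h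
  exact ⟨b, a, c, hb, ha, hc, by linarith, by module⟩

/-- The gauge (in the upper half plane) of the triangle `(-α,0), (1,0), (x1,x2)`. -/
def gau (α x1 x2 w1 w2 : ℝ) : ℝ :=
  max (w1 + (1 - x1) / x2 * w2) (-w1 / α + (1 + x1 / α) / x2 * w2)

lemma gau_pos {α x1 x2 w1 w2 : ℝ} (hα : 0 < α) (hx : 0 < x2) (h1 : 0 ≤ w1) (h2 : 0 ≤ w2)
    (h : 0 < w1 + w2) : 0 < gau α x1 x2 w1 w2 := by
  unfold gau
  by_contra hc
  rw [not_lt, max_le_iff] at hc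
  obtain ⟨ha, hb⟩ := hc
  rcases h2.eq_or_lt with h2 | h2
  · subst h2
    simp at ha h
    linarith
  · have e : (w1 + (1 - x1) / x2 * w2) + α * (-w1 / α + (1 + x1 / α) / x2 * w2)
        = (1 + α) * w2 / x2 := by field_simp; ring
    have : 0 < (1 + α) * w2 / x2 := by positivity
    nlinarith

lemma gau_smul {α x1 x2 w1 w2 c : ℝ} (hc : 0 ≤ c) :
    gau α x1 x2 (c * w1) (c * w2) = c * gau α x1 x2 w1 w2 := by
  unfold gau
  rw [mul_max_of_nonneg _ _ hc]
  congr 1 <;> ring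

lemma gau_path {α x1 x2 w1 w2 : ℝ} (hα : 0 < α) (hx : 0 < x2) (h2 : 0 ≤ w2)
    (h : gau α x1 x2 w1 w2 = 1) (o u v : Pt) :
    (o + w1 • u + w2 • v ∈ segment ℝ (o + u) (o + x1 • u + x2 • v)) ∨
    (o + w1 • u + w2 • v ∈ segment ℝ (o - α • u) (o + x1 • u + x2 • v)) := by
  have ht : 0 ≤ w2 / x2 := by positivity
  have e2 : w2 = (w2 / x2) * x2 := by field_simp
  generalize hT : w2 / x2 = t at *
  have ea : w1 + (1 - x1) / x2 * w2 = w1 + (1 - x1) * t := by rw [← hT]; ring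
  have eb : -w1 / α + (1 + x1 / α) / x2 * w2 = (- w1 + (α + x1) * t) / α := by
    rw [← hT]; field_simp
  unfold gau at h
  rw [ea, eb] at h
  have h1 := (max_le_iff.1 h.le).1
  have h1' := (max_le_iff.1 h.le).2
  rw [div_le_one hα] at h1'
  have htt : t ≤ 1 := by nlinarith
  rcases max_choice (w1 + (1 - x1) * t) ((- w1 + (α + x1) * t) / α) with hm | hm
  · left
    rw [hm] at h
    refine ⟨1 - t, t, by linarith, ht, by ring, ?_⟩
    have : w1 = 1 - t + t * x1 := by linarith
    rw [e2, this]
    module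
  · right
    rw [hm, div_eq_one_iff_eq hα.ne'] at h
    refine ⟨1 - t, t, by linarith, ht, by ring, ?_⟩
    have : w1 = -(1 - t) * α + t * x1 := by linarith
    rw [e2, this]
    module

lemma gau_tip {α x1 x2 : ℝ} (hα : 0 < α) (hx : 0 < x2) (o u v : Pt)
    (hn : ¬ InTri (o - α • u) (o + u) (o + x1 • u + x2 • v) (o + v)) :
    1 < gau α x1 x2 0 1 := by
  by_contra h
  rw [not_lt] at h
  apply hn
  unfold gau at h
  obtain ⟨h1, h2⟩ := max_le_iff.1 h
  have h1 : 1 - x1 ≤ x2 := by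
    rw [zero_add, mul_one, div_le_one hx] at h1; exact h1
  have h2 : α + x1 ≤ α * x2 := by
    have : (1 + x1 / α) ≤ x2 := by
      rw [neg_zero, zero_div, zero_add, mul_one, div_le_one hx] at h2; exact h2
    have h3 := mul_le_mul_of_nonneg_left this hα.le
    have : α * (1 + x1 / α) = α + x1 := by field_simp
    linarith
  refine ⟨(x2 - 1 + x1) / (x2 * (1 + α)), (α * x2 - α - x1) / (x2 * (1 + α)), 1 / x2,
    div_nonneg (by linarith) (by positivity), div_nonneg (by linarith) (by positivity),
    by positivity, by field_simp; ring, ?_⟩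
  have ho : (x2 - 1 + x1) / (x2 * (1 + α)) + (α * x2 - α - x1) / (x2 * (1 + α)) + 1 / x2 = 1 := by
    field_simp; ring
  have hu : -α * ((x2 - 1 + x1) / (x2 * (1 + α))) + (α * x2 - α - x1) / (x2 * (1 + α))
      + 1 / x2 * x1 = 0 := by
    field_simp; ring
  have hv : 1 / x2 * x2 = 1 := by field_simp
  generalize (x2 - 1 + x1) / (x2 * (1 + α)) = a at *
  generalize (α * x2 - α - x1) / (x2 * (1 + α)) = b at *
  generalize 1 / x2 = c at *
  calc o + v = (1:ℝ) • o + (0:ℝ) • u + (1:ℝ) • v := by module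
    _ = (a + b + c) • o + (-α * a + b + c * x1) • u + (c * x2) • v := by rw [ho, hu, hv]
    _ = _ := by module

lemma gau_q {α x1 x2 : ℝ} (hα : 0 < α) : gau α x1 x2 1 0 = 1 := by
  unfold gau
  rw [max_eq_left]
  · ring
  · have : 0 < 1 / α := by positivity
    have e : -1 / α = -(1 / α) := by ring
    rw [e]; linarith

lemma core {α β x1 x2 y1 y2 : ℝ} (hα : 0 < α) (hβ : 0 < β) (hx : 0 < x2) (hy : 0 < y1)
    (o u v : Pt)
    (hn : ¬ InTri (o - α • u) (o + u) (o + x1 • u + x2 • v) (o + v))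
    (hn' : ¬ InTri (o - β • v) (o + v) (o + y1 • u + y2 • v) (o + u)) :
    ∃ w, (w ∈ segment ℝ (o + u) (o + x1 • u + x2 • v) ∨
          w ∈ segment ℝ (o - α • u) (o + x1 • u + x2 • v)) ∧
         (w ∈ segment ℝ (o + v) (o + y1 • u + y2 • v) ∨
          w ∈ segment ℝ (o - β • v) (o + y1 • u + y2 • v)) := by
  have ey : o + y1 • u + y2 • v = o + y2 • v + y1 • u := by module
  rw [ey] at hn' ⊢
  have A := gau_tip hα hx o u v hn
  have B := gau_tip hβ hy o v u hn'
  have A' := gau_q (x1 := x1) (x2 := x2) hα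
  have B' := gau_q (x1 := y2) (x2 := y1) hβ
  let F : ℝ → ℝ := fun t => gau α x1 x2 (1 - t) t - gau β y2 y1 t (1 - t)
  have hF : ContinuousOn F (Icc 0 1) := by
    apply Continuous.continuousOn
    unfold F gau
    fun_prop
  have hz : (0:ℝ) ∈ Icc (F 0) (F 1) := by
    simp only [F, mem_Icc, sub_zero, sub_self]
    constructor <;> linarith
  obtain ⟨t, ⟨ht0, ht1⟩, ht⟩ := intermediate_value_Icc zero_le_one hF hz
  have hp : 0 < gau α x1 x2 (1 - t) t := gau_pos hα hx (by linarith) ht0 (by linarith)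
  have he : gau β y2 y1 t (1 - t) = gau α x1 x2 (1 - t) t := by
    simp only [F] at ht; linarith
  set c := (gau α x1 x2 (1 - t) t)⁻¹ with hc
  have hc0 : 0 < c := by positivity
  have g1 : gau α x1 x2 (c * (1 - t)) (c * t) = 1 := by
    rw [gau_smul hc0.le, hc]; exact inv_mul_cancel₀ hp.ne'
  have g2 : gau β y2 y1 (c * t) (c * (1 - t)) = 1 := by
    rw [gau_smul hc0.le, he, hc]; exact inv_mul_cancel₀ hp.ne'
  refine ⟨o + (c * (1 - t)) • u + (c * t) • v, gau_path hα hx (by positivity) g1 o u v, ?_⟩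
  have := gau_path hβ hy (mul_nonneg hc0.le (by linarith)) g2 o v u
  rwa [add_right_comm o ((c * t) • v)] at this

/-- Version of `core` with arbitrary signs. -/
lemma core' {α β x1 x2 y1 y2 : ℝ} (hα : 0 < α) (hβ : 0 < β) (hx : x2 ≠ 0) (hy : y1 ≠ 0)
    (o u v p q r s x y : Pt) (hq : q = o + u) (hp : p = o - α • u) (hr : r = o + v)
    (hs : s = o - β • v) (hxx : x = o + x1 • u + x2 • v) (hyy : y = o + y1 • u + y2 • v)
    (nr : ¬ InTri p q x r) (ns : ¬ InTri p q x s) (np : ¬ InTri r s y p) (nq : ¬ InTri r s y q) :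
    ∃ w, (w ∈ segment ℝ p x ∨ w ∈ segment ℝ q x) ∧ (w ∈ segment ℝ r y ∨ w ∈ segment ℝ s y) := by
  have ep : p = o + (-α) • u := by rw [hp]; module
  have eq' : q = o - α⁻¹ • ((-α) • u) := by
    rw [hq, smul_smul]; have : α⁻¹ * -α = -1 := by field_simp
    rw [this]; module
  have es : s = o + (-β) • v := by rw [hs]; module
  have er : r = o - β⁻¹ • ((-β) • v) := by
    rw [hr, smul_smul]; have : β⁻¹ * -β = -1 := by field_simp
    rw [this]; module
  have hα' : 0 < α⁻¹ := by positivity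
  have hβ' : 0 < β⁻¹ := by positivity
  have ea : ∀ a : ℝ, a • u = (-a / α) • ((-α) • u) := by
    intro a; rw [smul_smul]; congr 1; field_simp
  have eb : ∀ a : ℝ, a • v = (-a / β) • ((-β) • v) := by
    intro a; rw [smul_smul]; congr 1; field_simp
  rcases lt_or_gt_of_ne hx with hx | hx <;> rcases lt_or_gt_of_ne hy with hy | hy
  · have hxx' := hxx
    have hyy' := hyy
    rw [ea, eb] at hxx' hyy'
    have := core (x1 := -x1 / α) (y2 := -y2 / β) hα' hβ'
      (div_pos (neg_pos.2 hx) hβ) (div_pos (neg_pos.2 hy) hα) o ((-α) • u) ((-β) • v)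
    rw [← hxx', ← hyy', ← ep, ← eq', ← es, ← er] at this
    obtain ⟨w, h1, h2⟩ := this (fun h => ns h.swap) (fun h => np h)
    exact ⟨w, h1, h2.symm⟩
  · have hxx' := hxx
    have hyy' := hyy
    rw [eb] at hxx' hyy'
    have := core (x1 := x1) (y2 := -y2 / β) hα hβ'
      (div_pos (neg_pos.2 hx) hβ) hy o u ((-β) • v)
    rw [← hxx', ← hyy', ← hp, ← hq, ← es, ← er] at this
    obtain ⟨w, h1, h2⟩ := this ns nq
    exact ⟨w, h1.symm, h2.symm⟩
  · have hxx' := hxx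
    have hyy' := hyy
    rw [ea] at hxx' hyy'
    have := core (x1 := -x1 / α) (y2 := y2) hα' hβ
      hx (div_pos (neg_pos.2 hy) hα) o ((-α) • u) v
    rw [← hxx', ← hyy', ← ep, ← eq', ← hs, ← hr] at this
    obtain ⟨w, h1, h2⟩ := this (fun h => nr h.swap) (fun h => np h.swap)
    exact ⟨w, h1, h2⟩
  · have := core (x1 := x1) (y2 := y2) hα hβ hx hy o u v
    rw [← hxx, ← hyy, ← hp, ← hq, ← hs, ← hr] at this
    obtain ⟨w, h1, h2⟩ := this nr (fun h => nq h.swap)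
    exact ⟨w, h1.symm, h2⟩

lemma not_inTri {D : Set Pt} (hD : Convex ℝ D) {p q x w : Pt} (hp : p ∈ closure D)
    (hq : q ∈ closure D) (hx : x ∈ interior D) (hw : w ∉ interior D)
    (hnc : ¬ Collinear ℝ {p, q, w}) : ¬ InTri p q x w := by
  rintro ⟨a, b, c, ha, hb, hc, h1, rfl⟩
  rcases hc.eq_or_lt with hc | hc
  · subst hc
    apply hnc
    rw [collinear_iff_of_mem (p₀ := p) (by simp)]
    refine ⟨q - p, ?_⟩
    have : a = 1 - b := by linarith
    subst this
    intro z hz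
    simp only [mem_insert_iff, mem_singleton_iff] at hz
    rcases hz with rfl | rfl | rfl
    · exact ⟨0, by simp⟩
    · exact ⟨1, by simp⟩
    · exact ⟨b, by simp only [vadd_eq_add]; module⟩
  · apply hw
    rcases (show 0 ≤ a + b by positivity).eq_or_lt with hab | hab
    · have ha0 : a = 0 := by linarith
      have hb0 : b = 0 := by linarith
      have hc1 : c = 1 := by linarith
      subst ha0 hb0 hc1
      simpa using hx
    · have hm : (a / (a + b)) • p + (b / (a + b)) • q ∈ closure D :=
        hD.closure hp hq (by positivity) (by positivity) (by field_simp)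
      have := hD.combo_interior_closure_mem_interior hx hm hc hab.le (by linarith)
      convert this using 1
      rw [smul_add, smul_smul, smul_smul, mul_div_cancel₀ _ hab.ne', mul_div_cancel₀ _ hab.ne']
      module

lemma cone_nhds {a z w x : Pt} {ε : ℝ} (hz : z ∈ Metric.ball x ε) (hw : w ∈ segment ℝ a z)
    (hne : w ≠ a) : ∃ U : Set Pt, IsOpen U ∧ w ∈ U ∧
      ∀ w' ∈ U, ∃ z ∈ Metric.ball x ε, w' ∈ segment ℝ a z := by
  obtain ⟨b, t, hb, ht, hbt, rfl⟩ := hw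
  have hb' : b = 1 - t := by linarith
  subst hb'
  have ht0 : t ≠ 0 := by
    rintro rfl
    simp at hne
  refine ⟨(fun w => a + t⁻¹ • (w - a)) ⁻¹' Metric.ball x ε,
    Metric.isOpen_ball.preimage (by fun_prop), ?_, ?_⟩
  · rw [mem_preimage]
    convert hz using 1
    have : (1 - t) • a + t • z - a = t • (z - a) := by module
    rw [this, inv_smul_smul₀ ht0]
    module
  · intro w' hw'
    refine ⟨_, hw', 1 - t, t, hb, ht, hbt, ?_⟩
    simp only [smul_add, smul_inv_smul₀ ht0]
    module

lemma exists_shift (x v : Pt) {ε : ℝ} (hε : 0 < ε) (c : ℝ) :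
    ∃ δ : ℝ, x + δ • v ∈ Metric.ball x ε ∧ c + δ ≠ 0 := by
  by_cases hc : c = 0
  · refine ⟨ε / (‖v‖ + 1), ?_, ?_⟩
    · rw [mem_ball_iff_norm, add_sub_cancel_left, norm_smul, Real.norm_of_nonneg (by positivity),
        div_mul_eq_mul_div, div_lt_iff₀ (by positivity)]
      nlinarith [norm_nonneg v]
    · rw [hc, zero_add]; positivity
  · exact ⟨0, by simpa using hε, by simpa using hc⟩

lemma exists_coords (o u v x : Pt) (hD : cross2 u v ≠ 0) :
    ∃ a b : ℝ, x = o + a • u + b • v := by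
  refine ⟨cross2 (x - o) v / cross2 u v, cross2 u (x - o) / cross2 u v, ?_⟩
  have key : ∀ z c d e A B : ℝ, (z - c) * cross2 u v = A * d + B * e →
      z = c + A / cross2 u v * d + B / cross2 u v * e := by
    intro z c d e A B h
    field_simp
    linarith
  ext i
  fin_cases i
  · simp only [PiLp.add_apply, PiLp.smul_apply, smul_eq_mul]
    apply key
    simp [cross2]; ring
  · simp only [PiLp.add_apply, PiLp.smul_apply, smul_eq_mul]
    apply key
    simp [cross2]; ring

lemma cross_ne (o u v : Pt) (α : ℝ) (h : ¬ Collinear ℝ {o - α • u, o + u, o + v}) :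
    cross2 u v ≠ 0 := by
  intro hD
  have key : ∀ w : Pt, ∀ a b c : ℝ, u = a • w → v = b • w → False := by
    intro w a b c hu hv
    apply h
    rw [collinear_iff_exists_forall_eq_smul_vadd]
    refine ⟨o, w, ?_⟩
    intro z hz
    simp only [mem_insert_iff, mem_singleton_iff] at hz
    rcases hz with rfl | rfl | rfl
    · exact ⟨-α * a, by rw [hu]; simp only [vadd_eq_add]; module⟩
    · exact ⟨a, by rw [hu]; simp only [vadd_eq_add]; module⟩
    · exact ⟨b, by rw [hv]; simp only [vadd_eq_add]; module⟩
  unfold cross2 at hD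
  by_cases h0 : u 0 = 0
  · by_cases h1 : u 1 = 0
    · refine key v 0 1 0 ?_ (by simp)
      ext i
      fin_cases i <;> simp [h0, h1]
    · refine key u 1 (v 1 / u 1) 0 (by simp) ?_
      ext i
      fin_cases i
      · simp [h0, h1] at hD ⊢
        exact hD
      · simp; field_simp
  · refine key u 1 (v 0 / u 0) 0 (by simp) ?_
    ext i
    fin_cases i
    · simp; field_simp
    · simp; field_simp; linarith

lemma open_decomp {p q o : Pt} (h : o ∈ openSegment ℝ p q) :
    ∃ α : ℝ, 0 < α ∧ p = o - α • (q - o) := by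
  obtain ⟨a, b, ha, hb, hab, rfl⟩ := h
  refine ⟨b / a, by positivity, ?_⟩
  have h1 : q - (a • p + b • q) = a • (q - p) := by
    have : b = 1 - a := by linarith
    subst this; module
  rw [h1, smul_smul, div_mul_cancel₀ _ ha.ne']
  have : a = 1 - b := by linarith
  subst this; module

/-- Planarity of the Delaunay graph: under the empty-homothet and disjoint-bowtie
conditions, the open segments `pq` and `rs` do not cross. -/
theorem delaunay_edges_do_not_cross
    (C : Set Pt) (hC : IsCompact C) (hconv : Convex ℝ C) (h0 : (0:Pt) ∈ interior C)
    (p q r s : Pt)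
    (hdistinct : [p, q, r, s].Pairwise (· ≠ ·))
    (hnc₁ : ¬ Collinear ℝ {p, q, r}) (hnc₂ : ¬ Collinear ℝ {p, q, s})
    (hnc₃ : ¬ Collinear ℝ {p, r, s}) (hnc₄ : ¬ Collinear ℝ {q, r, s})
    (x : Pt) (lam : ℝ) (hlam : 0 < lam)
    (hpx : p ∈ frontier (homothet C x lam)) (hqx : q ∈ frontier (homothet C x lam))
    (hrx : r ∉ interior (homothet C x lam)) (hsx : s ∉ interior (homothet C x lam))
    (y : Pt) (mu : ℝ) (hmu : 0 < mu)
    (hry : r ∈ frontier (homothet C y mu)) (hsy : s ∈ frontier (homothet C y mu))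
    (hpy : p ∉ interior (homothet C y mu)) (hqy : q ∉ interior (homothet C y mu))
    (ε ε' : ℝ) (hε : 0 < ε) (hε' : 0 < ε')
    (hballx : Metric.ball x ε ⊆ interior (homothet C x lam))
    (hbally : Metric.ball y ε' ⊆ interior (homothet C y mu))
    (hmeas : volume
      ({w : Pt | ∃ z ∈ Metric.ball x ε, w ∈ segment ℝ p z ∪ segment ℝ z q} ∩
       {w : Pt | ∃ z ∈ Metric.ball y ε', w ∈ segment ℝ r z ∪ segment ℝ z s}) = 0) :
    openSegment ℝ p q ∩ openSegment ℝ r s = ∅ := by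
  rw [Set.eq_empty_iff_forall_notMem]
  rintro o ⟨ho1, ho2⟩
  obtain ⟨α, hα, hp⟩ := open_decomp ho1
  obtain ⟨β, hβ, hs⟩ := open_decomp (openSegment_symm ℝ r s ▸ ho2)
  have hq : q = o + (q - o) := by module
  have hr : r = o + (r - o) := by module
  have hD : cross2 (q - o) (r - o) ≠ 0 := by
    apply cross_ne o _ _ α
    rw [← hp, ← hq, ← hr]
    exact hnc₁
  obtain ⟨x1, x2, hx⟩ := exists_coords o _ _ x hD
  obtain ⟨y1, y2, hy⟩ := exists_coords o _ _ y hD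
  obtain ⟨δ, hδ, hδ0⟩ := exists_shift x (r - o) hε x2
  obtain ⟨η, hη, hη0⟩ := exists_shift y (q - o) hε' y1
  have hC1 : Convex ℝ (homothet C x lam) := hconv.affinity x lam
  have hC2 : Convex ℝ (homothet C y mu) := hconv.affinity y mu
  have perm : ∀ a b c : Pt, ({a, b, c} : Set Pt) = {b, c, a} := by
    intro a b c; ext z; simp only [mem_insert_iff, mem_singleton_iff]; tauto
  have nr := not_inTri hC1 (frontier_subset_closure hpx) (frontier_subset_closure hqx)
    (hballx hδ) hrx hnc₁
  have ns := not_inTri hC1 (frontier_subset_closure hpx) (frontier_subset_closure hqx)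
    (hballx hδ) hsx hnc₂
  have np := not_inTri hC2 (frontier_subset_closure hry) (frontier_subset_closure hsy)
    (hbally hη) hpy (perm p r s ▸ hnc₃)
  have nq := not_inTri hC2 (frontier_subset_closure hry) (frontier_subset_closure hsy)
    (hbally hη) hqy (perm q r s ▸ hnc₄)
  obtain ⟨w, h1, h2⟩ := core' (x1 := x1) (y2 := y2) hα hβ hδ0 hη0 o (q - o) (r - o) p q r s
    (x + δ • (r - o)) (y + η • (q - o)) hq hp hr hs
    (by nth_rewrite 1 [hx]; module) (by nth_rewrite 1 [hy]; module) nr ns np nq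
  have t1 : InTri p q (x + δ • (r - o)) w :=
    h1.elim InTri.of_segment_left InTri.of_segment_right
  have t2 : InTri r s (y + η • (q - o)) w :=
    h2.elim InTri.of_segment_left InTri.of_segment_right
  have wp : w ≠ p := fun h => np (h ▸ t2)
  have wq : w ≠ q := fun h => nq (h ▸ t2)
  have wr : w ≠ r := fun h => nr (h ▸ t1)
  have ws : w ≠ s := fun h => ns (h ▸ t1)
  have U1 : ∃ U : Set Pt, IsOpen U ∧ w ∈ U ∧
      U ⊆ {w : Pt | ∃ z ∈ Metric.ball x ε, w ∈ segment ℝ p z ∪ segment ℝ z q} := by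
    rcases h1 with h | h
    · obtain ⟨U, hU, hw, hs⟩ := cone_nhds hδ h wp
      refine ⟨U, hU, hw, fun w' hw' => ?_⟩
      obtain ⟨z, hz, hz'⟩ := hs w' hw'
      exact ⟨z, hz, Or.inl hz'⟩
    · obtain ⟨U, hU, hw, hs⟩ := cone_nhds hδ h wq
      refine ⟨U, hU, hw, fun w' hw' => ?_⟩
      obtain ⟨z, hz, hz'⟩ := hs w' hw'
      exact ⟨z, hz, Or.inr (segment_symm ℝ q z ▸ hz')⟩
  have U2 : ∃ U : Set Pt, IsOpen U ∧ w ∈ U ∧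
      U ⊆ {w : Pt | ∃ z ∈ Metric.ball y ε', w ∈ segment ℝ r z ∪ segment ℝ z s} := by
    rcases h2 with h | h
    · obtain ⟨U, hU, hw, hs⟩ := cone_nhds hη h wr
      refine ⟨U, hU, hw, fun w' hw' => ?_⟩
      obtain ⟨z, hz, hz'⟩ := hs w' hw'
      exact ⟨z, hz, Or.inl hz'⟩
    · obtain ⟨U, hU, hw, hs⟩ := cone_nhds hη h ws
      refine ⟨U, hU, hw, fun w' hw' => ?_⟩
      obtain ⟨z, hz, hz'⟩ := hs w' hw'
      exact ⟨z, hz, Or.inr (segment_symm ℝ s z ▸ hz')⟩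
  obtain ⟨U, hU, hwU, hUs⟩ := U1
  obtain ⟨V, hV, hwV, hVs⟩ := U2
  have hpos := (hU.inter hV).measure_pos volume ⟨w, hwU, hwV⟩
  exact absurd (measure_mono_null (inter_subset_inter hUs hVs) hmeas) hpos.ne'
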